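/- Fix q ≥ 3. Let φ be a Boolean formula in q-CNF with variables x_1,…,x_n and clauses C_1,…,C_m, each clause containing exactly q pairwise distinct variables, and let G and 𝓗 be produced by the following construction, where α(i) denotes the number of clause occurrences of variable x_i. For each variable x_i, create an induced cycle (the variable cycle) on the 4α(i) vertices v_i^{1,T}, v_i^{1,F}, v_i^{2,T}, v_i^{2,F}, …, v_i^{2α(i),T}, v_i^{2α(i),F}, in this cyclic order; the pair (v_i^{j,T}, v_i^{j,F}) is the j-th segment. For each even j, attach to each of v_i^{j,T} and v_i^{j,F} a new induced path on q−2 vertices (an attachment path) by an edge to one of its endpoints. Assign to each clause C_t containing x_i or ¬x_i a distinct number p ∈ {1,…,α(i)} and set j := 2p−1; if C_t contains the literal x_i, attach an attachment path to v_i^{j,F} and set γ_i^t := v_i^{j,T}; if C_t contains ¬x_i, attach an attachment path to v_i^{j,T} and set γ_i^t := v_i^{j,F}. For each clause C_t, let Π_t be the set of its q literal vertices γ_i^t and add edges so that G[Π_t] is an induced path P_q. The packing 𝓗 consists of, for each segment of each variable cycle, the induced P_q formed by the two segment vertices together with the q−2 vertices of one attachment path attached to that segment. Then 𝓗 is a vertex-disjoint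 packing of induced P_q's of G, and G has a vertex set S with |S| = |𝓗| such that G[V ∖ S] contains no induced path on q vertices if and only if φ is satisfiable. -/

import Mathlib

open SimpleGraph

/-! Construction 3 of the paper (hardness of `P_q`-free Vertex Deletion with
`P_q`-packing).  A `q`-CNF formula has variables `x_0, …, x_{n-1}` and clauses
`C_0, …, C_{m-1}`; the literal at position `a` of clause `t` is `C t a`, a pair of a
variable and a sign, the `q` variables of each clause being pairwise distinct.
`α i` is the number of clause occurrences of variable `x_i`, and `seg t a ∈ {0, …, α i - 1}`
is the distinct number assigned to the occurrence of variable `i = (C t a).1` in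
clause `t` (0-based; the paper's `p ∈ {1, …, α(i)}`).

Vertices: for each variable `x_i` a cycle on the vertices `(i, j, b)` with
`j : Fin (2 * α i)` (the paper's segment index, 0-based) and `b : Bool`
(`true` = `T`, `false` = `F`); and attachment paths on `q - 2` vertices
`(i, j, b, s)` with `s : Fin (q - 2)`, present exactly when `AttachOK i j b` holds:
for every `b` on even (paper: odd) positions of a segment pair, and on the vertex
complementary to the literal vertex `γ` for segments assigned to a clause occurrence. -/

/-- Cycle vertices `v_i^{j,T}` / `v_i^{j,F}` (0-based `j`). -/
abbrev PqCycV (n : ℕ) (α : Fin n → ℕ) := Σ i : Fin n, Fin (2 * α i) × Bool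

/-- Where attachment paths are attached. -/
def AttachOK {q n m : ℕ} (C : Fin m → Fin q → Fin n × Bool) (α : Fin n → ℕ)
    (seg : Fin m → Fin q → ℕ) (i : Fin n) (j : Fin (2 * α i)) (b : Bool) : Prop :=
  (j : ℕ) % 2 = 1 ∨
    ∃ (t : Fin m) (a : Fin q), (C t a).1 = i ∧ (j : ℕ) = 2 * seg t a ∧ b = !(C t a).2

instance {q n m : ℕ} (C : Fin m → Fin q → Fin n × Bool) (α : Fin n → ℕ)
    (seg : Fin m → Fin q → ℕ) (i : Fin n) (j : Fin (2 * α i)) (b : Bool) :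
    Decidable (AttachOK C α seg i j b) := by
  unfold AttachOK; infer_instance

/-- The vertices of the constructed graph: cycle vertices and attachment-path
vertices. -/
abbrev PqVert (q : ℕ) {n m : ℕ} (C : Fin m → Fin q → Fin n × Bool) (α : Fin n → ℕ)
    (seg : Fin m → Fin q → ℕ) :=
  PqCycV n α ⊕
    {x : Σ i : Fin n, (Fin (2 * α i) × Bool) × Fin (q - 2) //
      AttachOK C α seg x.1 x.2.1.1 x.2.1.2}

/-- The literal vertex `γ_i^t` for the occurrence of variable `i = (C t a).1` at
position `a` of clause `t`: the vertex `v_i^{j,T}` (`b = true`) if the literal is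
positive and `v_i^{j,F}` otherwise, on the segment `j = 2 * seg t a` assigned to this
occurrence. -/
def litVert {q n m : ℕ} (C : Fin m → Fin q → Fin n × Bool) (α : Fin n → ℕ)
    (seg : Fin m → Fin q → ℕ) (hseg_lt : ∀ t a, seg t a < α (C t a).1)
    (t : Fin m) (a : Fin q) : PqCycV n α :=
  ⟨(C t a).1, (⟨2 * seg t a, by have := hseg_lt t a; omega⟩, (C t a).2)⟩

/-- The edges of the constructed graph: the variable cycles, the attachment paths with
their attaching edges, and the clause paths `G[Π_t]` (the `q` literal vertices of each
clause joined in an induced path, in the order of the literal positions). -/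
def pqGraph (q : ℕ) {n m : ℕ} (C : Fin m → Fin q → Fin n × Bool) (α : Fin n → ℕ)
    (seg : Fin m → Fin q → ℕ) (hseg_lt : ∀ t a, seg t a < α (C t a).1) :
    SimpleGraph (PqVert q C α seg) :=
  SimpleGraph.fromRel (fun u v =>
    (∃ (i : Fin n) (j : Fin (2 * α i)),
      u = Sum.inl ⟨i, (j, true)⟩ ∧ v = Sum.inl ⟨i, (j, false)⟩) ∨
    (∃ (i : Fin n) (j j' : Fin (2 * α i)), (j' : ℕ) = ((j : ℕ) + 1) % (2 * α i) ∧
      u = Sum.inl ⟨i, (j, false)⟩ ∧ v = Sum.inl ⟨i, (j', true)⟩) ∨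
    (∃ (i : Fin n) (j : Fin (2 * α i)) (b : Bool) (s s' : Fin (q - 2))
      (h : AttachOK C α seg i j b) (h' : AttachOK C α seg i j b),
      (s' : ℕ) = (s : ℕ) + 1 ∧
      u = Sum.inr ⟨⟨i, ((j, b), s)⟩, h⟩ ∧ v = Sum.inr ⟨⟨i, ((j, b), s')⟩, h'⟩) ∨
    (∃ (i : Fin n) (j : Fin (2 * α i)) (b : Bool) (s : Fin (q - 2))
      (h : AttachOK C α seg i j b), (s : ℕ) = 0 ∧
      u = Sum.inl ⟨i, (j, b)⟩ ∧ v = Sum.inr ⟨⟨i, ((j, b), s)⟩, h⟩) ∨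
    (∃ (t : Fin m) (a a' : Fin q), (a' : ℕ) = (a : ℕ) + 1 ∧
      u = Sum.inl (litVert C α seg hseg_lt t a) ∧
      v = Sum.inl (litVert C α seg hseg_lt t a')))

/-- The side (`T` or `F`) of one (arbitrarily chosen) attachment path attached to the
segment `(i, j)`. -/
def chosenB {q n m : ℕ} (C : Fin m → Fin q → Fin n × Bool) (α : Fin n → ℕ)
    (seg : Fin m → Fin q → ℕ) (i : Fin n) (j : Fin (2 * α i)) : Bool :=
  if AttachOK C α seg i j true then true else false

open Classical in
/-- The packing `P_q` of the segment `(i, j)`: the two segment vertices together with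
the `q - 2` vertices of one attachment path attached to that segment. -/
noncomputable def segPq (q : ℕ) {n m : ℕ} (C : Fin m → Fin q → Fin n × Bool) (α : Fin n → ℕ)
    (seg : Fin m → Fin q → ℕ) (i : Fin n) (j : Fin (2 * α i)) :
    Finset (PqVert q C α seg) :=
  Finset.univ.filter (fun x =>
    x = Sum.inl ⟨i, (j, true)⟩ ∨ x = Sum.inl ⟨i, (j, false)⟩ ∨
    ∃ y : {x : Σ i : Fin n, (Fin (2 * α i) × Bool) × Fin (q - 2) //
        AttachOK C α seg x.1 x.2.1.1 x.2.1.2},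
      x = Sum.inr y ∧ ∃ s : Fin (q - 2), y.1 = ⟨i, ((j, chosenB C α seg i j), s)⟩)

open Classical in
/-- The packing `𝓗`: one `P_q` for each segment of each variable cycle. -/
noncomputable def pqPacking (q : ℕ) {n m : ℕ} (C : Fin m → Fin q → Fin n × Bool) (α : Fin n → ℕ)
    (seg : Fin m → Fin q → ℕ) : Finset (Finset (PqVert q C α seg)) :=
  Finset.univ.image (fun x : Σ i : Fin n, Fin (2 * α i) => segPq q C α seg x.1 x.2)

/-- `s` induces a path on `q` vertices in `G`. -/
def IsInducedPathN {V : Type*} (G : SimpleGraph V) (s : Finset V) (q : ℕ) : Prop :=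
  s.card = q ∧ Nonempty ((G.induce (↑s : Set V)) ≃g SimpleGraph.pathGraph q)

namespace PqConstruction

section Paths

variable {V : Type*} {G : SimpleGraph V} {q : ℕ}

lemma isInducedPathN_image [DecidableEq V] (f : Fin q → V) (hf : Function.Injective f)
    (hadj : ∀ a b, G.Adj (f a) (f b) ↔ (pathGraph q).Adj a b) :
    IsInducedPathN G (Finset.univ.image f) q := by
  refine ⟨by simp [Finset.card_image_of_injective _ hf], ⟨RelIso.symm ⟨?_, ?_⟩⟩⟩
  · exact (Equiv.ofInjective f hf).trans (Equiv.setCongr (by simp))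
  · intro a b
    exact hadj a b

lemma label_eq_of_isInducedPathN {β : Type*} {s : Finset V} (hs : IsInducedPathN G s q)
    (label : V → β) (hlabel : ∀ x ∈ s, ∀ y ∈ s, G.Adj x y → label x = label y)
    {x y : V} (hx : x ∈ s) (hy : y ∈ s) : label x = label y := by
  obtain ⟨_, ⟨e⟩⟩ := hs
  have hpre : (G.induce (s : Set V)).Preconnected :=
    e.preconnected_iff.2 (pathGraph_preconnected q)
  obtain ⟨w⟩ := hpre ⟨x, hx⟩ ⟨y, hy⟩
  have key : ∀ u v : (s : Set V), (G.induce (s : Set V)).Walk u v → label u = label v := by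
    intro u v w
    induction w with
    | nil => rfl
    | cons h _ ih => exact (hlabel _ (Subtype.prop _) _ (Subtype.prop _) h).trans ih
  exact key _ _ w

end Paths

variable {q n m : ℕ} {C : Fin m → Fin q → Fin n × Bool} {α : Fin n → ℕ}
  {seg : Fin m → Fin q → ℕ} {hseg_lt : ∀ t a, seg t a < α (C t a).1}

/-- The `s`-th vertex of the attachment path at the cycle vertex `v`. -/
def attachVert (v : PqCycV n α) (h : AttachOK C α seg v.1 v.2.1 v.2.2) (s : Fin (q - 2)) :
    PqVert q C α seg :=
  Sum.inr ⟨⟨v.1, (v.2, s)⟩, h⟩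

/-- The cycle vertex at which an attachment path vertex hangs; the identity on cycle vertices. -/
def anchor : PqVert q C α seg → PqCycV n α
  | Sum.inl u => u
  | Sum.inr p => ⟨p.1.1, p.1.2.1⟩

/-- The segment to which a vertex belongs. -/
def segOf (x : PqVert q C α seg) : Σ i : Fin n, Fin (2 * α i) :=
  ⟨(anchor x).1, (anchor x).2.1⟩

lemma adj_inl_attachVert {u v : PqCycV n α} {h : AttachOK C α seg v.1 v.2.1 v.2.2}
    {s : Fin (q - 2)} :
    (pqGraph q C α seg hseg_lt).Adj (Sum.inl u) (attachVert v h s) ↔ (s : ℕ) = 0 ∧ u = v := by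
  obtain ⟨i, x⟩ := v
  simp only [pqGraph, attachVert, fromRel_adj]
  constructor
  · rintro ⟨-, h | h⟩
    · rcases h with ⟨_, _, h, h'⟩ | ⟨_, _, _, _, h, h'⟩ | ⟨_, _, _, _, _, _, _, _, h, h'⟩ |
        ⟨i, j, b, s', h1, h0, h, h'⟩ | ⟨_, _, _, _, h, h'⟩
      · cases h'
      · cases h'
      · cases h
      · cases h; cases h'; exact ⟨h0, rfl⟩
      · cases h'
    · rcases h with ⟨_, _, h, h'⟩ | ⟨_, _, _, _, h, h'⟩ | ⟨_, _, _, _, _, _, _, _, h, h'⟩ |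
        ⟨i, j, b, s', h1, h0, h, h'⟩ | ⟨_, _, _, _, h, h'⟩
      · cases h
      · cases h
      · cases h'
      · cases h
      · cases h
  · rintro ⟨hs, rfl⟩
    exact ⟨by simp, Or.inl (Or.inr (Or.inr (Or.inr (Or.inl
      ⟨i, x.1, x.2, s, h, hs, rfl, rfl⟩))))⟩

lemma adj_attachVert_attachVert {v : PqCycV n α} {h : AttachOK C α seg v.1 v.2.1 v.2.2}
    {s s' : Fin (q - 2)} :
    (pqGraph q C α seg hseg_lt).Adj (attachVert v h s) (attachVert v h s') ↔
      (s : ℕ) + 1 = s' ∨ (s' : ℕ) + 1 = s := by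
  obtain ⟨i, x⟩ := v
  simp only [pqGraph, attachVert, fromRel_adj]
  constructor
  · rintro ⟨-, h | h⟩
    · rcases h with ⟨_, _, h, h'⟩ | ⟨_, _, _, _, h, h'⟩ | ⟨_, _, _, _, _, _, _, hs, h, h'⟩ |
        ⟨i, j, b, s', h1, h0, h, h'⟩ | ⟨_, _, _, _, h, h'⟩
      · cases h
      · cases h
      · cases h; cases h'; exact Or.inl hs.symm
      · cases h
      · cases h
    · rcases h with ⟨_, _, h, h'⟩ | ⟨_, _, _, _, h, h'⟩ | ⟨_, _, _, _, _, _, _, hs, h, h'⟩ |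
        ⟨i, j, b, s', h1, h0, h, h'⟩ | ⟨_, _, _, _, h, h'⟩
      · cases h
      · cases h
      · cases h; cases h'; exact Or.inr hs.symm
      · cases h
      · cases h
  · intro hs
    refine ⟨?_, ?_⟩
    · intro he
      cases he
      omega
    · rcases hs with hs | hs
      · exact Or.inl (Or.inr (Or.inr (Or.inl
          ⟨i, x.1, x.2, s, s', h, h, hs.symm, rfl, rfl⟩)))
      · exact Or.inr (Or.inr (Or.inr (Or.inl
          ⟨i, x.1, x.2, s', s, h, h, hs.symm, rfl, rfl⟩)))

lemma adj_segment (i : Fin n) (j : Fin (2 * α i)) (b : Bool) :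
    (pqGraph q C α seg hseg_lt).Adj (Sum.inl ⟨i, (j, !b)⟩) (Sum.inl ⟨i, (j, b)⟩) := by
  simp only [pqGraph, fromRel_adj]
  cases b
  · exact ⟨by simp, Or.inl (Or.inl ⟨i, j, rfl, rfl⟩)⟩
  · exact ⟨by simp, Or.inr (Or.inl ⟨i, j, rfl, rfl⟩)⟩

lemma adj_next_segment (i : Fin n) (j j' : Fin (2 * α i))
    (h : (j' : ℕ) = ((j : ℕ) + 1) % (2 * α i)) :
    (pqGraph q C α seg hseg_lt).Adj (Sum.inl ⟨i, (j, false)⟩) (Sum.inl ⟨i, (j', true)⟩) := by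
  simp only [pqGraph, fromRel_adj]
  exact ⟨by simp, Or.inl (Or.inr (Or.inl ⟨i, j, j', h, rfl, rfl⟩))⟩

lemma litVert_inj
    (hseg_inj : ∀ t a t' a', (C t a).1 = (C t' a').1 → seg t a = seg t' a' → t = t' ∧ a = a')
    {t t' : Fin m} {a a' : Fin q}
    (h : litVert C α seg hseg_lt t a = litVert C α seg hseg_lt t' a') : t = t' ∧ a = a' := by
  have h1 : (C t a).1 = (C t' a').1 := congrArg Sigma.fst h
  have h2 : 2 * seg t a = 2 * seg t' a' :=
    congrArg (fun v : PqCycV n α => (v.2.1 : ℕ)) h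
  exact hseg_inj _ _ _ _ h1 (by omega)

lemma adj_litVert
    (hC : ∀ t : Fin m, Function.Injective fun a : Fin q => (C t a).1)
    (hseg_inj : ∀ t a t' a', (C t a).1 = (C t' a').1 → seg t a = seg t' a' → t = t' ∧ a = a')
    {t : Fin m} {a a' : Fin q} :
    (pqGraph q C α seg hseg_lt).Adj (Sum.inl (litVert C α seg hseg_lt t a))
      (Sum.inl (litVert C α seg hseg_lt t a')) ↔ (a : ℕ) + 1 = a' ∨ (a' : ℕ) + 1 = a := by
  have hvar : ∀ (b b' : Fin q) (i : Fin n) (x x' : Fin (2 * α i) × Bool),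
      (Sum.inl (litVert C α seg hseg_lt t b) : PqVert q C α seg) = Sum.inl ⟨i, x⟩ →
      (Sum.inl (litVert C α seg hseg_lt t b') : PqVert q C α seg) = Sum.inl ⟨i, x'⟩ →
      b = b' := by
    intro b b' i x x' h h'
    have h1 : (C t b).1 = i := congrArg (fun v : PqCycV n α => v.1) (Sum.inl.inj h)
    have h2 : (C t b').1 = i := congrArg (fun v : PqCycV n α => v.1) (Sum.inl.inj h')
    exact hC t (h1.trans h2.symm)
  simp only [pqGraph, fromRel_adj]
  constructor
  · rintro ⟨hne, h | h⟩
    · rcases h with ⟨_, _, h, h'⟩ | ⟨_, _, _, _, h, h'⟩ | ⟨_, _, _, _, _, _, _, hs, h, h'⟩ |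
        ⟨i, j, b, s', h1, h0, h, h'⟩ | ⟨t', b, b', hb, h, h'⟩
      · exact absurd (by rw [hvar _ _ _ _ _ h h']) hne
      · exact absurd (by rw [hvar _ _ _ _ _ h h']) hne
      · cases h
      · cases h'
      · obtain ⟨-, rfl⟩ := litVert_inj hseg_inj (Sum.inl.inj h)
        obtain ⟨-, rfl⟩ := litVert_inj hseg_inj (Sum.inl.inj h')
        exact Or.inl hb.symm
    · rcases h with ⟨_, _, h, h'⟩ | ⟨_, _, _, _, h, h'⟩ | ⟨_, _, _, _, _, _, _, hs, h, h'⟩ |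
        ⟨i, j, b, s', h1, h0, h, h'⟩ | ⟨t', b, b', hb, h, h'⟩
      · exact absurd (by rw [hvar _ _ _ _ _ h h']) hne
      · exact absurd (by rw [hvar _ _ _ _ _ h h']) hne
      · cases h
      · cases h'
      · obtain ⟨-, rfl⟩ := litVert_inj hseg_inj (Sum.inl.inj h)
        obtain ⟨-, rfl⟩ := litVert_inj hseg_inj (Sum.inl.inj h')
        exact Or.inr hb.symm
  · intro hs
    refine ⟨?_, ?_⟩
    · intro he
      obtain ⟨-, rfl⟩ := litVert_inj hseg_inj (Sum.inl.inj he)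
      omega
    · rcases hs with hs | hs
      · exact Or.inl (Or.inr (Or.inr (Or.inr (Or.inr ⟨t, a, a', hs.symm, rfl, rfl⟩))))
      · exact Or.inr (Or.inr (Or.inr (Or.inr (Or.inr ⟨t, a', a, hs.symm, rfl, rfl⟩))))

/-- The path running from the cycle vertex `w` through `v` along the attachment path at `v`. -/
def hangingPath (w v : PqCycV n α) (h : AttachOK C α seg v.1 v.2.1 v.2.2) (k : Fin q) :
    PqVert q C α seg :=
  if h0 : (k : ℕ) = 0 then Sum.inl w
  else if h1 : (k : ℕ) = 1 then Sum.inl v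
  else attachVert v h ⟨k - 2, by omega⟩

lemma isInducedPathN_hangingPath {w v : PqCycV n α} (h : AttachOK C α seg v.1 v.2.1 v.2.2)
    (hwv : (pqGraph q C α seg hseg_lt).Adj (Sum.inl w) (Sum.inl v)) :
    IsInducedPathN (pqGraph q C α seg hseg_lt) (Finset.univ.image (hangingPath w v h)) q := by
  have hne : w ≠ v := fun e => hwv.ne (congrArg Sum.inl e)
  apply isInducedPathN_image
  · intro a b hab
    unfold hangingPath at hab
    split_ifs at hab with h1 h2 h3 h4 h5 h6 h7 h8
    all_goals first
      | (apply Fin.ext; omega)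
      | exact absurd (Sum.inl.inj hab) hne
      | exact absurd (Sum.inl.inj hab).symm hne
      | cases hab
      | skip
    simp only [attachVert, Sum.inr.injEq, Subtype.mk.injEq, Sigma.mk.injEq, heq_eq_eq,
      Prod.mk.injEq, Fin.mk.injEq, true_and] at hab
    apply Fin.ext
    omega
  · intro a b
    rw [pathGraph_adj]
    unfold hangingPath
    split_ifs
    all_goals first
      | (simp only [adj_attachVert_attachVert]; omega)
      | (simp only [adj_inl_attachVert, hne, and_false, and_true, false_iff]; omega)
      | (rw [adj_comm]; simp only [adj_inl_attachVert, hne, and_false, and_true, false_iff]; omega)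
      | (simp only [hwv, true_iff]; omega)
      | (simp only [hwv.symm, true_iff]; omega)
      | (simp only [SimpleGraph.irrefl, false_iff]; omega)

lemma attachOK_chosenB
    (hseg_surj : ∀ (i : Fin n) (p : ℕ), p < α i → ∃ t a, (C t a).1 = i ∧ seg t a = p)
    (i : Fin n) (j : Fin (2 * α i)) : AttachOK C α seg i j (chosenB C α seg i j) := by
  unfold chosenB
  split_ifs with h
  · exact h
  · rcases Nat.mod_two_eq_zero_or_one j with hj | hj
    · obtain ⟨t, a, h1, h2⟩ := hseg_surj i (j / 2) (by omega)
      have h3 : (j : ℕ) = 2 * seg t a := by omega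
      refine Or.inr ⟨t, a, h1, h3, ?_⟩
      cases hb : (C t a).2
      · exact absurd (Or.inr ⟨t, a, h1, h3, by simp [hb]⟩) h
      · rfl
    · exact Or.inl hj

lemma litVert_ne_of_attachOK
    (hseg_inj : ∀ t a t' a', (C t a).1 = (C t' a').1 → seg t a = seg t' a' → t = t' ∧ a = a')
    {v : PqCycV n α} (h : AttachOK C α seg v.1 v.2.1 v.2.2) (t : Fin m) (a : Fin q) :
    litVert C α seg hseg_lt t a ≠ v := by
  rintro rfl
  rcases h with h | ⟨t', a', h1, h2, h3⟩
  · simp [litVert] at h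
  · simp only [litVert] at h1 h2 h3
    obtain ⟨rfl, rfl⟩ := hseg_inj _ _ _ _ h1 (by omega)
    simp at h3

lemma segPq_eq_image (hq : 3 ≤ q) (i : Fin n) (j : Fin (2 * α i))
    (h : AttachOK C α seg i j (chosenB C α seg i j)) :
    segPq q C α seg i j =
      Finset.univ.image (hangingPath (q := q) (⟨i, (j, !chosenB C α seg i j)⟩ : PqCycV n α)
        ⟨i, (j, chosenB C α seg i j)⟩ h) := by
  ext x
  simp only [segPq, Finset.mem_filter, Finset.mem_univ, true_and, Finset.mem_image]
  have hends : (x = Sum.inl ⟨i, (j, true)⟩ ∨ x = Sum.inl ⟨i, (j, false)⟩) ↔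
      (x = Sum.inl ⟨i, (j, !chosenB C α seg i j)⟩ ∨
        x = Sum.inl ⟨i, (j, chosenB C α seg i j)⟩) := by
    cases chosenB C α seg i j <;> simp [or_comm]
  rw [← or_assoc, hends]
  constructor
  · rintro ((rfl | rfl) | ⟨⟨y, hy⟩, rfl, s, hs⟩)
    · exact ⟨⟨0, by omega⟩, by simp [hangingPath]⟩
    · exact ⟨⟨1, by omega⟩, by simp [hangingPath]⟩
    · refine ⟨⟨s + 2, by omega⟩, ?_⟩
      subst hs
      simp [hangingPath, attachVert]
  · rintro ⟨k, rfl⟩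
    unfold hangingPath
    split_ifs
    · simp
    · simp
    · exact Or.inr ⟨_, rfl, _, rfl⟩

lemma segOf_eq_of_mem {i : Fin n} {j : Fin (2 * α i)} {x : PqVert q C α seg}
    (hx : x ∈ segPq q C α seg i j) : segOf x = ⟨i, j⟩ := by
  simp only [segPq, Finset.mem_filter, Finset.mem_univ, true_and] at hx
  rcases hx with rfl | rfl | ⟨⟨y, hy⟩, rfl, s, hs⟩
  · rfl
  · rfl
  · subst hs; rfl

lemma inl_mem_segPq (i : Fin n) (j : Fin (2 * α i)) :
    (Sum.inl ⟨i, (j, true)⟩ : PqVert q C α seg) ∈ segPq q C α seg i j := by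
  simp [segPq]

lemma disjoint_segPq {x y : Σ i : Fin n, Fin (2 * α i)} (hxy : x ≠ y) :
    Disjoint (segPq q C α seg x.1 x.2) (segPq q C α seg y.1 y.2) :=
  Finset.disjoint_left.2 fun _ h h' =>
    hxy ((segOf_eq_of_mem h).symm.trans (segOf_eq_of_mem h'))

lemma card_pqPacking :
    (pqPacking q C α seg).card = Fintype.card (Σ i : Fin n, Fin (2 * α i)) := by
  unfold pqPacking
  classical
  refine (Finset.card_image_of_injective _ fun x y hxy => ?_).trans Finset.card_univ
  have h := inl_mem_segPq (q := q) (C := C) (seg := seg) x.1 x.2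
  have hx := segOf_eq_of_mem h
  rw [hxy] at h
  exact hx.symm.trans (segOf_eq_of_mem h)

/-- A vertex set as small as the packing that meets every packing path contains at most one
vertex of each segment. -/
lemma injOn_segOf_of_card {S : Finset (PqVert q C α seg)}
    (hcard : S.card = (pqPacking q C α seg).card)
    (hmeet : ∀ i j, ∃ x ∈ S, x ∈ segPq q C α seg i j) :
    Set.InjOn segOf (S : Set (PqVert q C α seg)) := by
  refine Finset.injOn_of_surjOn_of_card_le segOf (t := Finset.univ)
    (fun _ _ => Finset.mem_coe.2 (Finset.mem_univ _)) (fun x _ => ?_) ?_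
  · obtain ⟨y, hy, hyx⟩ := hmeet x.1 x.2
    exact ⟨y, hy, segOf_eq_of_mem hyx⟩
  · rw [hcard, card_pqPacking, Finset.card_univ]

lemma forall_of_cyclic_step {N : ℕ} {p : Fin N → Prop}
    (hstep : ∀ j j' : Fin N, (j' : ℕ) = ((j : ℕ) + 1) % N → p j → p j')
    {j₀ : Fin N} (h₀ : p j₀) (j : Fin N) : p j := by
  have hN : 0 < N := j₀.pos
  have key : ∀ k : ℕ, p ⟨((j₀ : ℕ) + k) % N, Nat.mod_lt _ hN⟩ := by
    intro k
    induction k with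
    | zero => simpa [Nat.mod_eq_of_lt j₀.2] using h₀
    | succ k ih => exact hstep _ _ (by simp [← add_assoc]) ih
  have h := key (N - j₀ + j)
  have he : ((j₀ : ℕ) + (N - j₀ + j)) % N = j := by
    rw [show (j₀ : ℕ) + (N - j₀ + j) = j + N by omega, Nat.add_mod_right, Nat.mod_eq_of_lt j.2]
  simpa [he] using h

/-- In a solution as small as the packing, the choice of `T` propagates along each cycle. -/
lemma true_mem_next
    {S : Finset (PqVert q C α seg)}
    (hinj : Set.InjOn segOf (S : Set (PqVert q C α seg)))
    (hhang : ∀ (w v : PqCycV n α), AttachOK C α seg v.1 v.2.1 v.2.2 →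
      (pqGraph q C α seg hseg_lt).Adj (Sum.inl w) (Sum.inl v) →
      ∃ x ∈ S, x = Sum.inl w ∨ anchor x = v)
    (i : Fin n) (j j' : Fin (2 * α i)) (hj' : (j' : ℕ) = ((j : ℕ) + 1) % (2 * α i))
    (hj : Sum.inl ⟨i, (j, true)⟩ ∈ S) : Sum.inl ⟨i, (j', true)⟩ ∈ S := by
  have hfalse : ∀ x ∈ S, anchor x ≠ ⟨i, (j, false)⟩ := by
    intro x hx hax
    have := hinj hx hj (by unfold segOf; rw [hax]; rfl)
    subst this
    simp [anchor] at hax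
  rcases Nat.mod_two_eq_zero_or_one j with hpar | hpar
  · have hlt : (j : ℕ) + 1 < 2 * α i := by omega
    rw [Nat.mod_eq_of_lt hlt] at hj'
    have hodd : ∀ b, AttachOK C α seg i j' b := fun b => Or.inl (by omega)
    obtain ⟨x, hx, hxw | hxv⟩ := hhang _ ⟨i, (j', false)⟩ (hodd false)
      (adj_segment (hseg_lt := hseg_lt) i j' false)
    · exact hxw ▸ hx
    · obtain ⟨y, hy, rfl | hyv⟩ := hhang _ ⟨i, (j', true)⟩ (hodd true)
        (adj_next_segment (hseg_lt := hseg_lt) i j j' (by rw [Nat.mod_eq_of_lt hlt, hj']))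
      · exact absurd rfl (hfalse _ hy)
      · have := hinj hx hy (by unfold segOf; rw [hxv, hyv])
        subst this
        simp [hxv] at hyv
  · obtain ⟨x, hx, rfl | hxv⟩ := hhang _ ⟨i, (j, false)⟩ (Or.inl hpar)
      (adj_next_segment (hseg_lt := hseg_lt) i j j' hj').symm
    · exact hx
    · exact absurd hxv (hfalse x hx)

lemma satisfiable_of_deletion_set (hq : 3 ≤ q)
    (hC : ∀ t : Fin m, Function.Injective fun a : Fin q => (C t a).1)
    (hseg_inj : ∀ t a t' a', (C t a).1 = (C t' a').1 → seg t a = seg t' a' → t = t' ∧ a = a')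
    (hseg_surj : ∀ (i : Fin n) (p : ℕ), p < α i → ∃ t a, (C t a).1 = i ∧ seg t a = p)
    {S : Finset (PqVert q C α seg)} (hcard : S.card = (pqPacking q C α seg).card)
    (hS : ∀ s : Finset (PqVert q C α seg), Disjoint s S →
      ¬ IsInducedPathN (pqGraph q C α seg hseg_lt) s q) :
    ∃ σ : Fin n → Bool, ∀ t : Fin m, ∃ a : Fin q, σ (C t a).1 = (C t a).2 := by
  have hhit : ∀ s, IsInducedPathN (pqGraph q C α seg hseg_lt) s q → ∃ x ∈ S, x ∈ s := by
    intro s hs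
    by_contra! hcon
    exact hS s (Finset.disjoint_right.2 hcon) hs
  have hinj := injOn_segOf_of_card hcard fun i j => hhit _ (by
    rw [segPq_eq_image hq i j (attachOK_chosenB hseg_surj i j)]
    exact isInducedPathN_hangingPath _ (adj_segment i j _))
  have hhang : ∀ (w v : PqCycV n α), AttachOK C α seg v.1 v.2.1 v.2.2 →
      (pqGraph q C α seg hseg_lt).Adj (Sum.inl w) (Sum.inl v) →
      ∃ x ∈ S, x = Sum.inl w ∨ anchor x = v := by
    intro w v h hwv
    obtain ⟨x, hx, hxs⟩ := hhit _ (isInducedPathN_hangingPath h hwv)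
    obtain ⟨k, -, rfl⟩ := Finset.mem_image.1 hxs
    refine ⟨_, hx, ?_⟩
    unfold hangingPath
    split_ifs
    · exact Or.inl rfl
    · exact Or.inr rfl
    · exact Or.inr rfl
  classical
  refine ⟨fun i => decide (∃ j, (Sum.inl ⟨i, (j, true)⟩ : PqVert q C α seg) ∈ S), fun t => ?_⟩
  obtain ⟨x, hx, hxs⟩ := hhit _ (isInducedPathN_image
    (G := pqGraph q C α seg hseg_lt)
    (fun a => Sum.inl (litVert C α seg hseg_lt t a))
    (fun a b hab => (litVert_inj hseg_inj (Sum.inl.inj hab)).2)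
    (fun a b => (adj_litVert hC hseg_inj).trans pathGraph_adj.symm))
  obtain ⟨a, -, rfl⟩ := Finset.mem_image.1 hxs
  refine ⟨a, ?_⟩
  cases hb : (C t a).2
  · simp only [decide_eq_false_iff_not]
    rintro ⟨j, hj⟩
    have hall := forall_of_cyclic_step
      (p := fun j => (Sum.inl ⟨(C t a).1, (j, true)⟩ : PqVert q C α seg) ∈ S)
      (true_mem_next hinj hhang _) hj (litVert C α seg hseg_lt t a).2.1
    have := hinj hx hall rfl
    simp [litVert, hb] at this
  · simp only [decide_eq_true_eq]
    exact ⟨_, by simpa only [litVert, hb] using hx⟩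

/-- The component of a vertex after deletion of the vertices given by an assignment: a literal
vertex is labelled by its clause, any other vertex by its anchor. -/
noncomputable def componentLabel (hseg_lt : ∀ t a, seg t a < α (C t a).1)
    (x : PqVert q C α seg) : PqCycV n α ⊕ Fin m :=
  open Classical in
  if h : ∃ t a, litVert C α seg hseg_lt t a = anchor x then Sum.inr h.choose
  else Sum.inl (anchor x)

lemma componentLabel_litVert
    (hseg_inj : ∀ t a t' a', (C t a).1 = (C t' a').1 → seg t a = seg t' a' → t = t' ∧ a = a')
    (t : Fin m) (a : Fin q) :
    componentLabel hseg_lt (Sum.inl (litVert C α seg hseg_lt t a)) = Sum.inr t := by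
  have h : ∃ t' a', litVert C α seg hseg_lt t' a' =
      anchor (Sum.inl (litVert C α seg hseg_lt t a) : PqVert q C α seg) := ⟨t, a, rfl⟩
  unfold componentLabel
  rw [dif_pos h]
  obtain ⟨a', ha'⟩ := h.choose_spec
  rw [(litVert_inj hseg_inj ha').1]

lemma componentLabel_eq_of_adj
    (hseg_inj : ∀ t a t' a', (C t a).1 = (C t' a').1 → seg t a = seg t' a' → t = t' ∧ a = a')
    (σ : Fin n → Bool) {x y : PqVert q C α seg}
    (hx : ∀ i j, x ≠ Sum.inl ⟨i, (j, σ i)⟩) (hy : ∀ i j, y ≠ Sum.inl ⟨i, (j, σ i)⟩)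
    (hxy : (pqGraph q C α seg hseg_lt).Adj x y) :
    componentLabel hseg_lt x = componentLabel hseg_lt y := by
  simp only [pqGraph, fromRel_adj] at hxy
  obtain ⟨-, h⟩ := hxy
  wlog hr : (∃ (i : Fin n) (j : Fin (2 * α i)),
      x = Sum.inl ⟨i, (j, true)⟩ ∧ y = Sum.inl ⟨i, (j, false)⟩) ∨
    (∃ (i : Fin n) (j j' : Fin (2 * α i)), (j' : ℕ) = ((j : ℕ) + 1) % (2 * α i) ∧
      x = Sum.inl ⟨i, (j, false)⟩ ∧ y = Sum.inl ⟨i, (j', true)⟩) ∨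
    (∃ (i : Fin n) (j : Fin (2 * α i)) (b : Bool) (s s' : Fin (q - 2))
      (h : AttachOK C α seg i j b) (h' : AttachOK C α seg i j b),
      (s' : ℕ) = (s : ℕ) + 1 ∧
      x = Sum.inr ⟨⟨i, ((j, b), s)⟩, h⟩ ∧ y = Sum.inr ⟨⟨i, ((j, b), s')⟩, h'⟩) ∨
    (∃ (i : Fin n) (j : Fin (2 * α i)) (b : Bool) (s : Fin (q - 2))
      (h : AttachOK C α seg i j b), (s : ℕ) = 0 ∧
      x = Sum.inl ⟨i, (j, b)⟩ ∧ y = Sum.inr ⟨⟨i, ((j, b), s)⟩, h⟩) ∨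
    (∃ (t : Fin m) (a a' : Fin q), (a' : ℕ) = (a : ℕ) + 1 ∧
      x = Sum.inl (litVert C α seg hseg_lt t a) ∧
      y = Sum.inl (litVert C α seg hseg_lt t a')) generalizing x y
  · exact (this hy hx h.symm (h.resolve_left hr)).symm
  rcases hr with ⟨i, j, rfl, rfl⟩ | ⟨i, j, j', -, rfl, rfl⟩ | ⟨i, j, b, s, s', _, _, -, rfl, rfl⟩ |
    ⟨i, j, b, s, _, -, rfl, rfl⟩ | ⟨t, a, a', -, rfl, rfl⟩
  · cases hσ : σ i
    · exact absurd (by rw [hσ]) (hy i j)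
    · exact absurd (by rw [hσ]) (hx i j)
  · cases hσ : σ i
    · exact absurd (by rw [hσ]) (hx i j)
    · exact absurd (by rw [hσ]) (hy i j')
  · rfl
  · rfl
  · rw [componentLabel_litVert hseg_inj, componentLabel_litVert hseg_inj]

/-- The position of a vertex within the hanging path that starts at its anchor. -/
def depth : PqVert q C α seg → ℕ
  | Sum.inl _ => 0
  | Sum.inr p => p.1.2.2 + 1

lemma eq_of_anchor_eq_of_depth_eq {x y : PqVert q C α seg} (ha : anchor x = anchor y)
    (hd : depth x = depth y) : x = y := by
  rcases x with u | ⟨⟨i, v, s⟩, hp⟩ <;> rcases y with u' | ⟨⟨i', v', s'⟩, hp'⟩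
  · exact congrArg Sum.inl ha
  · simp [depth] at hd
  · simp [depth] at hd
  · simp only [anchor] at ha
    cases ha
    simp only [depth, add_left_inj] at hd
    have := Fin.ext hd
    subst this
    rfl

lemma depth_lt (hq : 3 ≤ q) (x : PqVert q C α seg) : depth x < q - 1 := by
  rcases x with u | ⟨⟨i, v, s⟩, hp⟩
  · simp only [depth]; omega
  · simp only [depth]; omega

lemma card_lt_of_componentLabel_eq (hq : 3 ≤ q)
    (hseg_inj : ∀ t a t' a', (C t a).1 = (C t' a').1 → seg t a = seg t' a' → t = t' ∧ a = a')
    {σ : Fin n → Bool} (hσ : ∀ t : Fin m, ∃ a : Fin q, σ (C t a).1 = (C t a).2)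
    {s : Finset (PqVert q C α seg)} (hs : ∀ x ∈ s, ∀ i j, x ≠ Sum.inl ⟨i, (j, σ i)⟩)
    (l : PqCycV n α ⊕ Fin m) (hl : ∀ x ∈ s, componentLabel hseg_lt x = l) : s.card < q := by
  classical
  rcases l with v | t
  · have hv : ∀ x ∈ s, anchor x = v := by
      intro x hx
      have h := hl x hx
      unfold componentLabel at h
      split_ifs at h
      exact Sum.inl.inj h
    have : s.card ≤ (Finset.range (q - 1)).card :=
      Finset.card_le_card_of_injOn depth (fun x _ => by simpa using depth_lt hq x)
        fun x hx y hy hxy =>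
          eq_of_anchor_eq_of_depth_eq ((hv x hx).trans (hv y hy).symm) hxy
    rw [Finset.card_range] at this
    omega
  · obtain ⟨a₀, ha₀⟩ := hσ t
    have hsub : s ⊆ (Finset.univ.erase a₀).image
        fun a => (Sum.inl (litVert C α seg hseg_lt t a) : PqVert q C α seg) := by
      intro x hx
      have h := hl x hx
      unfold componentLabel at h
      split_ifs at h with hex
      obtain ⟨a, ha⟩ := hex.choose_spec
      rw [Sum.inr.inj h] at ha
      rcases x with u | p
      · refine Finset.mem_image.2 ⟨a, Finset.mem_erase.2 ⟨?_, Finset.mem_univ _⟩, congrArg _ ha⟩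
        rintro rfl
        refine hs _ hx (C t a).1 (litVert C α seg hseg_lt t a).2.1 ?_
        rw [ha₀]
        exact congrArg Sum.inl ha.symm
      · exact absurd ha (litVert_ne_of_attachOK hseg_inj (v := anchor (Sum.inr p)) p.2 t a)
    calc s.card ≤ _ := Finset.card_le_card hsub
      _ ≤ (Finset.univ.erase a₀).card := Finset.card_image_le
      _ < q := by rw [Finset.card_erase_of_mem (Finset.mem_univ _), Finset.card_fin]; omega

lemma deletion_set_of_satisfiable (hq : 3 ≤ q)
    (hseg_inj : ∀ t a t' a', (C t a).1 = (C t' a').1 → seg t a = seg t' a' → t = t' ∧ a = a')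
    {σ : Fin n → Bool} (hσ : ∀ t : Fin m, ∃ a : Fin q, σ (C t a).1 = (C t a).2) :
    ∃ S : Finset (PqVert q C α seg), S.card = (pqPacking q C α seg).card ∧
      ∀ s : Finset (PqVert q C α seg), Disjoint s S →
        ¬ IsInducedPathN (pqGraph q C α seg hseg_lt) s q := by
  classical
  let f : (Σ i : Fin n, Fin (2 * α i)) → PqVert q C α seg :=
    fun x => Sum.inl ⟨x.1, (x.2, σ x.1)⟩
  have hf : Function.LeftInverse segOf f := fun _ => rfl
  refine ⟨Finset.univ.image f, ?_, ?_⟩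
  · rw [Finset.card_image_of_injective _ hf.injective, card_pqPacking, Finset.card_univ]
  · intro s hdisj hpath
    have hs : ∀ x ∈ s, ∀ i j, x ≠ Sum.inl ⟨i, (j, σ i)⟩ := by
      rintro x hx i j rfl
      exact Finset.disjoint_left.1 hdisj hx (Finset.mem_image.2 ⟨⟨i, j⟩, Finset.mem_univ _, rfl⟩)
    obtain ⟨x₀, hx₀⟩ : s.Nonempty := Finset.card_pos.1 (by rw [hpath.1]; omega)
    refine (card_lt_of_componentLabel_eq (hseg_lt := hseg_lt) hq hseg_inj hσ hs
      (componentLabel hseg_lt x₀) fun x hx => ?_).ne hpath.1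
    exact label_eq_of_isInducedPathN hpath (componentLabel hseg_lt)
      (fun x hx y hy hxy => componentLabel_eq_of_adj hseg_inj σ (hs x hx) (hs y hy) hxy) hx hx₀

end PqConstruction

/-- Theorem 7 / Construction 3 of the paper. For `q ≥ 3` and a
`q`-CNF formula `φ` with pairwise distinct variables in each clause, the family `𝓗`
is a vertex-disjoint packing of induced `P_q`s of the constructed graph `G`, and `G`
has a vertex set `S` with `|S| = |𝓗|` such that `G[V ∖ S]` contains no induced path on
`q` vertices iff `φ` is satisfiable. -/
theorem stmt17 (q n m : ℕ) (hq : 3 ≤ q)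
    (C : Fin m → Fin q → Fin n × Bool)
    (hC : ∀ t : Fin m, Function.Injective fun a : Fin q => (C t a).1)
    (α : Fin n → ℕ) (seg : Fin m → Fin q → ℕ)
    (hseg_lt : ∀ t a, seg t a < α (C t a).1)
    (hseg_inj : ∀ t a t' a', (C t a).1 = (C t' a').1 → seg t a = seg t' a' →
      t = t' ∧ a = a')
    (hseg_surj : ∀ (i : Fin n) (p : ℕ), p < α i → ∃ t a, (C t a).1 = i ∧ seg t a = p) :
    (∀ P ∈ pqPacking q C α seg,
      IsInducedPathN (pqGraph q C α seg hseg_lt) P q) ∧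
    (∀ P₁ ∈ pqPacking q C α seg, ∀ P₂ ∈ pqPacking q C α seg, P₁ ≠ P₂ →
      Disjoint P₁ P₂) ∧
    ((∃ S : Finset (PqVert q C α seg), S.card = (pqPacking q C α seg).card ∧
        ∀ s : Finset (PqVert q C α seg), Disjoint s S →
          ¬ IsInducedPathN (pqGraph q C α seg hseg_lt) s q) ↔
      (∃ σ : Fin n → Bool, ∀ t : Fin m, ∃ a : Fin q, σ (C t a).1 = (C t a).2)) := by
  classical
  refine ⟨?_, ?_, ?_, ?_⟩
  · intro P hP
    obtain ⟨⟨i, j⟩, -, rfl⟩ := Finset.mem_image.1 hP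
    rw [PqConstruction.segPq_eq_image hq i j (PqConstruction.attachOK_chosenB hseg_surj i j)]
    exact PqConstruction.isInducedPathN_hangingPath _ (PqConstruction.adj_segment i j _)
  · intro P₁ h₁ P₂ h₂ hne
    obtain ⟨x, -, rfl⟩ := Finset.mem_image.1 h₁
    obtain ⟨y, -, rfl⟩ := Finset.mem_image.1 h₂
    exact PqConstruction.disjoint_segPq fun h => hne (by rw [h])
  · rintro ⟨S, hcard, hS⟩
    exact PqConstruction.satisfiable_of_deletion_set hq hC hseg_inj hseg_surj hcard hS
  · rintro ⟨σ, hσ⟩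
    exact PqConstruction.deletion_set_of_satisfiable hq hseg_inj hσ
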